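/- arXiv:2011.01626 — 3 statements merged into one kernel-verified Lean document; each statement's English description precedes it below -/
import Mathlib

section
/- Multigraph Turán theorem: for all a, r, s ∈ ℕ with s ≥ r + 1, and all integers n ≥ 2r(s+2) + r(s+2)·√(s−1), one has ex_Π(n, s, Σ_{r,0}(a,s)) = Π_{r,0}(a, n); moreover a multigraph G ∈ F(n, s, Σ_{r,0}(a,s)) satisfies P(G) = Π_{r,0}(a,n) if and only if G ∈ T_{r,0}(a,n) and P(G) = Π_{r,0}(a,n) (i.e. the product-extremal multigraphs are exactly the product-maximal members of T_{r,0}(a,n)). -/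
open Finset

/-- Sum of the edge multiplicities of the multigraph `w` inside the vertex set `X`
(edges are 2-element subsets of `Fin n`). -/
def edgeSum (n : ℕ) (w : Finset (Fin n) → ℕ) (X : Finset (Fin n)) : ℕ :=
  ∑ p ∈ X.powersetCard 2, w p

/-- Product of the edge multiplicities of the multigraph `w` inside the vertex set `X`. -/
def edgeProd (n : ℕ) (w : Finset (Fin n) → ℕ) (X : Finset (Fin n)) : ℕ :=
  ∏ p ∈ X.powersetCard 2, w p

/-- The product-degree of the vertex `v` in the multigraph `w`. -/
def pdeg (n : ℕ) (w : Finset (Fin n) → ℕ) (v : Fin n) : ℕ :=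
  ∏ u ∈ Finset.univ.erase v, w {u, v}

/-- `w` is an `(n,s,q)`-graph: every `s`-set of vertices spans at most `q` edges. -/
def IsF (n s q : ℕ) (w : Finset (Fin n) → ℕ) : Prop :=
  ∀ X : Finset (Fin n), X.card = s → edgeSum n w X ≤ q

/-- `ex_Π(n,s,q)`: the maximum of the product of all edge multiplicities over
`(n,s,q)`-graphs. -/
noncomputable def exPi (n s q : ℕ) : ℕ :=
  sSup {P | ∃ w : Finset (Fin n) → ℕ, IsF n s q w ∧ P = edgeProd n w Finset.univ}

/-- Membership in the family `T_{r,d}(a,n)`: the vertex set can be partitioned into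
parts `V_0, …, V_{r-1}` (given by a labelling `f`) so that edges inside `V_0` have
multiplicity `a - d`, edges inside `V_i` (`i ≥ 1`) have multiplicity `a`, and edges
between distinct parts have multiplicity `a + 1`. -/
def InT (n r d a : ℕ) (w : Finset (Fin n) → ℕ) : Prop :=
  ∃ f : Fin n → ℕ, (∀ v, f v < r) ∧
    ∀ u v : Fin n, u ≠ v →
      w {u, v} = if f u = f v then (if f u = 0 then a - d else a) else a + 1

/-- `Σ_{r,d}(a,n)`: the maximum number of edges of a member of `T_{r,d}(a,n)`. -/
noncomputable def SigmaT (r d a n : ℕ) : ℕ :=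
  sSup {e | ∃ w : Finset (Fin n) → ℕ, InT n r d a w ∧ e = edgeSum n w Finset.univ}

/-- `Π_{r,d}(a,n)`: the maximum product of edge multiplicities of a member of
`T_{r,d}(a,n)`. -/
noncomputable def PiT (r d a n : ℕ) : ℕ :=
  sSup {P | ∃ w : Finset (Fin n) → ℕ, InT n r d a w ∧ P = edgeProd n w Finset.univ}

/-- The number of edges of the `r`-partite Turán graph on `m` vertices. -/
def turanNum (r m : ℕ) : ℤ := ∑ i ∈ range m, ((i : ℤ) - (i / r : ℕ))

lemma turanNum_succ (r m : ℕ) : turanNum r (m + 1) = turanNum r m + ((m : ℤ) - (m / r : ℕ)) := by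
  unfold turanNum
  rw [sum_range_succ]

lemma two_mul_turanNum_of_decomp {r : ℕ} (hr : 1 ≤ r) (q p : ℕ) (hp : p ≤ r) :
    2 * turanNum r (q * r + p) =
      ((q * r + p : ℕ) : ℤ) * (((q * r + p : ℕ) : ℤ) - q) - p * (q + 1) := by
  induction q generalizing p with
  | zero =>
    induction p with
    | zero => simp [turanNum]
    | succ p ih =>
      have h := ih (by omega)
      have hd : (0 * r + p) / r = 0 := Nat.div_eq_of_lt (by omega)
      rw [← add_assoc, turanNum_succ, mul_add, h, hd]
      push_cast
      ring
  | succ q ihq =>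
    induction p with
    | zero =>
      have h := ihq r le_rfl
      rw [show (q + 1) * r + 0 = q * r + r by ring, h]
      push_cast
      ring
    | succ p ih =>
      have h := ih (by omega)
      have hd : ((q + 1) * r + p) / r = q + 1 := by
        rw [Nat.div_eq_iff (by omega)]
        constructor <;> [nlinarith; omega]
      rw [← add_assoc, turanNum_succ, mul_add, h, hd]
      push_cast
      ring

lemma two_mul_turanNum {r : ℕ} (hr : 1 ≤ r) (m : ℕ) :
    2 * turanNum r m = (m : ℤ) * (m - (m / r : ℕ)) - (m % r : ℕ) * ((m / r : ℕ) + 1) := by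
  have h := two_mul_turanNum_of_decomp hr (m / r) (m % r) (Nat.mod_lt _ hr).le
  rwa [Nat.div_add_mod' m r] at h

lemma two_mul_turanNum_succ {r : ℕ} (hr : 1 ≤ r) (k : ℕ) :
    2 * turanNum r (k + 1) =
      ((k : ℤ) + 1) * (k + 1 - (k / r : ℕ)) - ((k % r : ℕ) + 1) * ((k / r : ℕ) + 1) := by
  have h := two_mul_turanNum_of_decomp hr (k / r) (k % r + 1) (Nat.mod_lt _ hr)
  rw [← add_assoc, Nat.div_add_mod' k r] at h
  rw [h]
  push_cast
  ring

lemma two_mul_turanNum_succ_add_two_lt {r k : ℕ} (hr : 1 ≤ r) (hk : r + 1 ≤ k) :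
    2 * turanNum r (k + 1) + 2 < ((k : ℤ) + 1) * (k + 1 - (k / r : ℕ)) := by
  rw [two_mul_turanNum_succ hr]
  have h1 : 1 ≤ k / r := (Nat.one_le_div_iff hr).2 (by omega)
  have hdm := Nat.div_add_mod k r
  have : 2 < (k % r + 1) * (k / r + 1) := by
    rcases Nat.eq_zero_or_pos (k % r) with h0 | h0
    · have : 1 < k / r := by
        by_contra hc
        have : k / r = 1 := by omega
        rw [this, h0] at hdm
        omega
      rw [h0]
      omega
    · nlinarith
  have : (2 : ℤ) < ((k % r : ℕ) + 1) * ((k / r : ℕ) + 1) := by exact_mod_cast this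
  linarith

lemma turanNum_add_one_self {r : ℕ} (hr : 1 ≤ r) :
    turanNum r (r + 1) = (((r + 1).choose 2 : ℕ) : ℤ) - 1 := by
  have h := two_mul_turanNum_of_decomp hr 1 1 hr
  have h2 : (((r + 1).choose 2 : ℕ) : ℤ) * 2 = (r + 1) * r := by
    rw [Nat.choose_two_right]
    have h3 : 2 ∣ (r + 1) * (r + 1 - 1) := by
      simpa [mul_comm] using (Nat.even_mul_succ_self r).two_dvd
    exact_mod_cast Nat.div_mul_cancel h3
  rw [one_mul] at h
  push_cast at h
  linarith

section PairSums

variable {α : Type*} [DecidableEq α]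

/-- The sum of `g` over the pairs contained in `X`. -/
def pairSum (g : Finset α → ℤ) (X : Finset α) : ℤ := ∑ p ∈ X.powersetCard 2, g p

lemma pairSum_insert (g : Finset α → ℤ) {X : Finset α} {v : α} (hv : v ∉ X) :
    pairSum g (insert v X) = pairSum g X + ∑ u ∈ X, g {v, u} := by
  unfold pairSum
  rw [powersetCard_succ_insert hv, sum_union, sum_image]
  · congr 1
    rw [powersetCard_one, sum_map]
    rfl
  · intro p hp q hq h
    have hp' := (mem_powersetCard.1 hp).1
    have hq' := (mem_powersetCard.1 hq).1
    rw [← erase_insert (fun h => hv (hp' h)), h, erase_insert (fun h => hv (hq' h))]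
  · rw [disjoint_left]
    intro p hp hp'
    obtain ⟨q, -, rfl⟩ := mem_image.1 hp'
    exact hv ((mem_powersetCard.1 hp).1 (mem_insert_self _ _))

lemma pairSum_erase (g : Finset α → ℤ) {X : Finset α} {v : α} (hv : v ∈ X) :
    pairSum g X = pairSum g (X.erase v) + ∑ u ∈ X.erase v, g {v, u} := by
  rw [← pairSum_insert g (notMem_erase v X), insert_erase hv]

lemma sum_sum_erase (g : Finset α → ℤ) (X : Finset α) :
    ∑ v ∈ X, ∑ u ∈ X.erase v, g {v, u} = 2 * pairSum g X := by
  induction X using Finset.induction_on with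
  | empty => simp [pairSum, powersetCard_eq_empty.2 (card_empty.trans_lt two_pos)]
  | insert x X hx ih =>
    rw [sum_insert hx, erase_insert hx, pairSum_insert g hx, mul_add, ← ih]
    have : ∀ v ∈ X, ∑ u ∈ (insert x X).erase v, g {v, u}
        = g {x, v} + ∑ u ∈ X.erase v, g {v, u} := by
      intro v hv
      have hxv : x ≠ v := fun h => hx (h ▸ hv)
      rw [erase_insert_of_ne hxv, sum_insert (fun h => hx (mem_of_mem_erase h)), pair_comm]
    rw [sum_congr rfl this, sum_add_distrib]
    ring

lemma sum_pairSum_erase (g : Finset α → ℤ) (X : Finset α) :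
    ∑ v ∈ X, pairSum g (X.erase v) = (X.card - 2) * pairSum g X := by
  have h : ∑ v ∈ X, pairSum g X
      = ∑ v ∈ X, (pairSum g (X.erase v) + ∑ u ∈ X.erase v, g {v, u}) :=
    sum_congr rfl fun v hv => pairSum_erase g hv
  rw [sum_add_distrib, sum_sum_erase, sum_const, nsmul_eq_mul] at h
  linarith

/-- If every `s`-set spans at most as much as the Turán graph, so does every larger set. -/
lemma pairSum_le_turanNum {r s : ℕ} (hr : 1 ≤ r) (hs : r + 1 ≤ s) (g : Finset α → ℤ)
    (h : ∀ X : Finset α, X.card = s → pairSum g X ≤ turanNum r s) {m : ℕ} (hm : s ≤ m) :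
    ∀ X : Finset α, X.card = m → pairSum g X ≤ turanNum r m := by
  induction m, hm using Nat.le_induction with
  | base => exact h
  | succ k hk ih =>
    intro X hX
    have h1 : ∑ v ∈ X, pairSum g (X.erase v) ≤ ∑ v ∈ X, turanNum r k :=
      sum_le_sum fun v hv => ih _ (by rw [card_erase_of_mem hv, hX]; rfl)
    rw [sum_pairSum_erase, sum_const, nsmul_eq_mul, hX] at h1
    have h2 := two_mul_turanNum_succ_add_two_lt hr (hs.trans hk)
    have h3 := turanNum_succ r k
    by_contra! hc
    have hk2 : (2 : ℤ) ≤ k := by omega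
    push_cast at h1
    nlinarith

variable [Fintype α]

/-- If every `(m+1)`-set spans at most as much as the Turán graph and every vertex has at least
the minimum degree of the Turán graph on all the vertices, then the bound passes to `m`-sets. -/
lemma pairSum_le_turanNum_of_succ {r m : ℕ} (hr : 1 ≤ r) (g : Finset α → ℤ)
    (hn : 2 * r * (m + 1) < Fintype.card α)
    (hdeg : ∀ v : α, (Fintype.card α : ℤ) - 1 - ((Fintype.card α - 1) / r : ℕ)
      ≤ ∑ u ∈ univ.erase v, g {v, u})
    (h : ∀ X : Finset α, X.card = m + 1 → pairSum g X ≤ turanNum r (m + 1))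
    (Y : Finset α) (hY : Y.card = m) : pairSum g Y ≤ turanNum r m := by
  by_contra! hc
  have h1 : ∑ v ∈ Yᶜ, pairSum g (insert v Y) ≤ ∑ v ∈ Yᶜ, turanNum r (m + 1) :=
    sum_le_sum fun v hv => h _ (by rw [card_insert_of_notMem (mem_compl.1 hv), hY])
  rw [sum_congr rfl fun v hv => pairSum_insert g (mem_compl.1 hv), sum_add_distrib, sum_const,
    sum_const, nsmul_eq_mul, nsmul_eq_mul, turanNum_succ] at h1
  have h2 : ∑ v ∈ Y, ∑ u ∈ univ.erase v, g {v, u}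
      = 2 * pairSum g Y + ∑ v ∈ Yᶜ, ∑ u ∈ Y, g {v, u} := by
    rw [sum_comm (s := Yᶜ), ← sum_sum_erase, ← sum_add_distrib]
    refine sum_congr rfl fun v hv => ?_
    have hu : univ.erase v = Y.erase v ∪ Yᶜ := by
      ext u
      by_cases hu : u ∈ Y
      · simp [hu]
      · simpa [hu] using fun h : u = v => hu (h ▸ hv)
    rw [hu, sum_union (disjoint_left.2 fun u hu hu' =>
      mem_compl.1 hu' (mem_of_mem_erase hu))]
    congr 1
    exact sum_congr rfl fun u _ => by rw [pair_comm]
  have h3 := sum_le_sum fun v (_ : v ∈ Y) => hdeg v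
  rw [sum_const, nsmul_eq_mul, hY, h2] at h3
  have hcard : ((Yᶜ).card : ℤ) = Fintype.card α - m := by
    have := card_add_card_compl Y
    omega
  rw [hcard] at h1
  have ht := two_mul_turanNum hr m
  have hdm := Nat.div_add_mod m r
  have hp := Nat.mod_lt m hr
  have hc0 := Nat.div_mul_le_self (Fintype.card α - 1) r
  generalize hN : Fintype.card α = N at *
  generalize hq : m / r = q at *
  generalize m % r = p at *
  generalize hcc : (N - 1) / r = c at *
  have hc1 : (c : ℤ) * r ≤ N - 1 := by
    have : c * r + 1 ≤ N := by omega
    zify at this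
    linarith
  zify at hn hdm hp hr
  have hNm : (2 : ℤ) ≤ N - m := by nlinarith
  have h4 : ((N : ℤ) - m - 2) * (turanNum r m + 1) ≤ ((N : ℤ) - m - 2) * pairSum g Y :=
    mul_le_mul_of_nonneg_left (by linarith) (by linarith)
  have h5 : (N : ℤ) * (1 + q) - m - 2 - m * (c + 1) + p * q + p ≤ 0 := by nlinarith
  have h6 : (m : ℤ) * (c * r) ≤ m * (N - 1) := mul_le_mul_of_nonneg_left hc1 (by positivity)
  have h7 : (r : ℤ) * ((N : ℤ) * (1 + q) - m - 2 - m * (c + 1) + p * q + p) ≤ 0 :=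
    mul_nonpos_of_nonneg_of_nonpos (by linarith) h5
  have h8 : (0 : ℤ) ≤ r * (p * q + p) := by positivity
  have h9 : (0 : ℤ) ≤ N * (r - 1 - p) := mul_nonneg (by positivity) (by linarith)
  have h10 : (N : ℤ) * (r * q + p) = N * m := by rw [hdm]
  nlinarith

end PairSums

/-- The excess of the multigraph `w` over the constant multigraph of multiplicity `a`. -/
def excess {n : ℕ} (a : ℕ) (w : Finset (Fin n) → ℕ) (p : Finset (Fin n)) : ℤ := w p - a

lemma edgeSum_eq {n : ℕ} (a : ℕ) (w : Finset (Fin n) → ℕ) (X : Finset (Fin n)) :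
    (edgeSum n w X : ℤ) = a * (X.card.choose 2 : ℕ) + pairSum (excess a w) X := by
  simp only [edgeSum, pairSum, excess, sum_sub_distrib, sum_const, card_powersetCard]
  push_cast
  ring

lemma InT.eq_or_eq {n r a : ℕ} {w : Finset (Fin n) → ℕ} (h : InT n r 0 a w)
    {p : Finset (Fin n)} (hp : p.card = 2) : w p = a ∨ w p = a + 1 := by
  obtain ⟨f, -, hf⟩ := h
  obtain ⟨u, v, huv, rfl⟩ := card_eq_two.1 hp
  rw [hf u v huv]
  split_ifs <;> simp

lemma InT.pairSum_le {n r a : ℕ} {w : Finset (Fin n) → ℕ} (h : InT n r 0 a w) (hr : 1 ≤ r)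
    {m : ℕ} (hm : r + 1 ≤ m) (X : Finset (Fin n)) (hX : X.card = m) :
    pairSum (excess a w) X ≤ turanNum r m := by
  refine pairSum_le_turanNum hr le_rfl _ (fun Y hY => ?_) hm X hX
  have hle : ∀ p ∈ Y.powersetCard 2, excess a w p ≤ 1 := fun p hp => by
    rcases h.eq_or_eq (mem_powersetCard.1 hp).2 with h' | h' <;> simp [excess, h']
  obtain ⟨f, hf, hw⟩ := h
  obtain ⟨u, hu, v, hv, huv, hfuv⟩ := exists_ne_map_eq_of_card_lt_of_maps_to (s := Y)
    (t := range r) (f := f) (by simp [hY]) (fun v _ => by simpa using hf v)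
  have huv0 : excess a w {u, v} = 0 := by simp [excess, hw u v huv, hfuv]
  have : pairSum (excess a w) Y < ∑ p ∈ Y.powersetCard 2, 1 := by
    refine sum_lt_sum hle ⟨{u, v}, mem_powersetCard.2 ⟨?_, card_pair huv⟩, by simp [huv0]⟩
    simp [insert_subset_iff, hu, hv]
  rw [sum_const, card_powersetCard, hY, nsmul_eq_mul, mul_one] at this
  rw [turanNum_add_one_self hr]
  omega

lemma sum_range_mod_ne {r : ℕ} (hr : 1 ≤ r) (m : ℕ) :
    ∑ j ∈ range m, (if j % r = m % r then (0 : ℤ) else 1) = (m : ℤ) - (m / r : ℕ) := by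
  have h := Nat.count_modEq_card (b := m) hr m
  rw [if_neg (lt_irrefl _), add_zero, Nat.count_eq_card_filter_range] at h
  have h2 : ∀ j ∈ range m, (if j % r = m % r then (0 : ℤ) else 1)
      = 1 - if j ≡ m [MOD r] then 1 else 0 := fun j _ => by
    by_cases hj : j % r = m % r <;> simp [Nat.ModEq, hj]
  rw [sum_congr rfl h2, sum_sub_distrib, sum_boole, h]
  simp

lemma sum_sum_range_mod_ne {r : ℕ} (hr : 1 ≤ r) (m : ℕ) :
    ∑ i ∈ range m, ∑ j ∈ range m, (if i % r = j % r then (0 : ℤ) else 1)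
      = 2 * turanNum r m := by
  induction m with
  | zero => simp [turanNum]
  | succ m ih =>
    simp_rw [sum_range_succ]
    rw [sum_add_distrib, ih, sum_range_mod_ne hr, turanNum_succ]
    have := sum_range_mod_ne hr m
    simp_rw [eq_comm (a := _ % r) (b := m % r)] at this
    rw [this]
    simp
    ring

lemma card_edgeFinset_turanGraph_eq {n r : ℕ} (hr : 1 ≤ r) :
    ((SimpleGraph.turanGraph n r).edgeFinset.card : ℤ) = turanNum r n := by
  have h := (SimpleGraph.turanGraph n r).sum_degrees_eq_twice_card_edges
  have h2 := sum_sum_range_mod_ne hr n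
  rw [Finset.sum_range] at h2
  simp_rw [Finset.sum_range] at h2
  zify at h
  have h3 : ∀ v, ((SimpleGraph.turanGraph n r).degree v : ℤ)
      = ∑ u : Fin n, if (v : ℕ) % r = u % r then (0 : ℤ) else 1 := by
    intro v
    rw [← SimpleGraph.card_neighborFinset_eq_degree, SimpleGraph.neighborFinset_eq_filter]
    simp only [SimpleGraph.turanGraph_adj, card_filter]
    push_cast
    refine sum_congr rfl fun u _ => ?_
    split_ifs <;> simp_all
  simp_rw [h3] at h
  linarith

/-- The multigraph with multiplicity `a + 1` on the edges of the Turán graph and multiplicity `a`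
on all other pairs. -/
noncomputable def turanMultigraph (n r a : ℕ) (p : Finset (Fin n)) : ℕ := by
  classical
  exact if ∃ u ∈ p, ∃ v ∈ p, (u : ℕ) % r ≠ v % r then a + 1 else a

lemma turanMultigraph_pair (n r a : ℕ) (u v : Fin n) :
    turanMultigraph n r a {u, v} = if (u : ℕ) % r = v % r then a else a + 1 := by
  unfold turanMultigraph
  by_cases h : (u : ℕ) % r = v % r <;> simp [h, eq_comm]

lemma inT_turanMultigraph {n r : ℕ} (hr : 1 ≤ r) (a : ℕ) :
    InT n r 0 a (turanMultigraph n r a) :=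
  ⟨fun v => v % r, fun _ => Nat.mod_lt _ hr, fun u v _ => by simp [turanMultigraph_pair]⟩

lemma pairSum_turanMultigraph {n r : ℕ} (hr : 1 ≤ r) (a : ℕ) :
    pairSum (excess a (turanMultigraph n r a)) univ = turanNum r n := by
  have h := sum_sum_erase (excess a (turanMultigraph n r a)) univ
  have h2 := sum_sum_range_mod_ne hr n
  rw [Finset.sum_range] at h2
  simp_rw [Finset.sum_range] at h2
  have h3 : ∀ v : Fin n, ∑ u ∈ univ.erase v, excess a (turanMultigraph n r a) {v, u}
      = ∑ u : Fin n, if (v : ℕ) % r = u % r then (0 : ℤ) else 1 := by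
    intro v
    rw [← add_sum_erase univ _ (mem_univ v), if_pos rfl, zero_add]
    refine sum_congr rfl fun u _ => ?_
    rw [excess, turanMultigraph_pair]
    split_ifs <;> simp
  simp_rw [h3] at h
  linarith

lemma sigmaT_eq {r m : ℕ} (hr : 1 ≤ r) (hm : r + 1 ≤ m) (a : ℕ) :
    (SigmaT r 0 a m : ℤ) = a * (m.choose 2 : ℕ) + turanNum r m := by
  have hcard : (univ : Finset (Fin m)).card = m := by simp
  have h : IsGreatest {e | ∃ w : Finset (Fin m) → ℕ, InT m r 0 a w ∧ e = edgeSum m w univ}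
      (edgeSum m (turanMultigraph m r a) univ) := by
    refine ⟨⟨_, inT_turanMultigraph hr a, rfl⟩, ?_⟩
    rintro e ⟨w, hw, rfl⟩
    zify
    rw [edgeSum_eq a, edgeSum_eq a, pairSum_turanMultigraph hr]
    have := hw.pairSum_le hr hm univ hcard
    linarith
  rw [SigmaT, h.csSup_eq, edgeSum_eq a, pairSum_turanMultigraph hr, hcard]

/-- The function `x ↦ x (a / (a + 1)) ^ x` on the natural numbers attains its maximum exactly at
`a` and `a + 1`. -/
lemma mul_pow_le_and_eq {a : ℕ} (ha : 1 ≤ a) (x : ℕ) :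
    (x : ℝ) * (a / (a + 1)) ^ x ≤ a * ((a : ℝ) / (a + 1)) ^ a ∧
      ((x : ℝ) * (a / (a + 1)) ^ x = a * ((a : ℝ) / (a + 1)) ^ a ↔ x = a ∨ x = a + 1) := by
  have ha' : (0 : ℝ) < a := by exact_mod_cast ha
  set ρ : ℝ := a / (a + 1) with hρ
  have hρ0 : 0 < ρ := by positivity
  have hρ1 : ρ * (a + 1) = a := by rw [hρ]; field_simp
  have hstep : ∀ y : ℕ, ((y + 1 : ℕ) : ℝ) * ρ ^ (y + 1) - y * ρ ^ y
      = ρ ^ y * ((a - y) / (a + 1)) := by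
    intro y
    rw [hρ, pow_succ]
    push_cast
    field_simp
    ring
  have hlow : ∀ j : ℕ, ∀ y, y + j + 1 = a → (y : ℝ) * ρ ^ y < a * ρ ^ a := by
    intro j
    induction j with
    | zero =>
      rintro y rfl
      have := hstep y
      have h2 : 0 < ρ ^ y * (((y + 0 + 1 : ℕ) - y : ℝ) / ((y + 0 + 1 : ℕ) + 1)) := by
        push_cast
        ring_nf
        positivity
      simp only [add_zero] at *
      linarith
    | succ j ih =>
      intro y hy
      have h1 := ih (y + 1) (by omega)
      have hya : (y : ℝ) < a := by exact_mod_cast (by omega : y < a)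
      have h2 : 0 < ρ ^ y * ((a - y : ℝ) / (a + 1)) :=
        mul_pos (by positivity) (div_pos (by linarith) (by positivity))
      have := hstep y
      linarith
  have heq : ((a + 1 : ℕ) : ℝ) * ρ ^ (a + 1) = a * ρ ^ a := by
    have := hstep a
    simp only [sub_self, zero_div, mul_zero] at this
    linarith
  have hhigh : ∀ j : ℕ, ((a + 2 + j : ℕ) : ℝ) * ρ ^ (a + 2 + j) < a * ρ ^ a := by
    have key : ∀ y : ℕ, a < y → ((y + 1 : ℕ) : ℝ) * ρ ^ (y + 1) < y * ρ ^ y := by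
      intro y hy
      have hya : (a : ℝ) < y := by exact_mod_cast hy
      have h2 : ρ ^ y * ((a - y : ℝ) / (a + 1)) < 0 :=
        mul_neg_of_pos_of_neg (by positivity)
          (div_neg_of_neg_of_pos (by linarith) (by positivity))
      have := hstep y
      linarith
    intro j
    induction j with
    | zero => exact (key (a + 1) (by omega)).trans_eq heq
    | succ j ih => exact (key (a + 2 + j) (by omega)).trans ih
  rcases lt_trichotomy x a with h | rfl | h
  · have := hlow (a - x - 1) x (by omega)
    exact ⟨this.le, ⟨fun h' => absurd h' this.ne, fun h' => by omega⟩⟩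
  · simp
  · obtain rfl | h := (Nat.succ_le_of_lt h).eq_or_lt
    · exact ⟨heq.le, ⟨fun _ => Or.inr rfl, fun _ => heq⟩⟩
    · obtain ⟨j, rfl⟩ := Nat.exists_eq_add_of_le h
      have := hhigh j
      exact ⟨this.le, ⟨fun h' => absurd h' this.ne, fun h' => by omega⟩⟩

lemma edgeProd_mul_pow {n : ℕ} (w : Finset (Fin n) → ℕ) (ρ : ℝ) :
    (edgeProd n w univ : ℝ) * ρ ^ edgeSum n w univ
      = ∏ p ∈ univ.powersetCard 2, ((w p : ℝ) * ρ ^ w p) := by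
  rw [prod_mul_distrib, edgeProd, edgeSum, prod_pow_eq_pow_sum]
  push_cast
  rfl

/-- Among multigraphs with at most as many edges as one whose multiplicities are `a` and `a + 1`,
none has a larger product, and equality forces multiplicities `a`, `a + 1` and as many edges. -/
lemma edgeProd_le_of_edgeSum_le {n a : ℕ} (ha : 1 ≤ a) {w w₀ : Finset (Fin n) → ℕ}
    (h₀ : ∀ p : Finset (Fin n), p.card = 2 → w₀ p = a ∨ w₀ p = a + 1)
    (hle : edgeSum n w univ ≤ edgeSum n w₀ univ) :
    edgeProd n w univ ≤ edgeProd n w₀ univ ∧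
      (edgeProd n w univ = edgeProd n w₀ univ →
        edgeSum n w univ = edgeSum n w₀ univ ∧
          ∀ p : Finset (Fin n), p.card = 2 → w p = a ∨ w p = a + 1) := by
  have ha' : (0 : ℝ) < a := by exact_mod_cast ha
  set ρ : ℝ := a / (a + 1) with hρ
  have hρ0 : 0 < ρ := by positivity
  have hρ1 : ρ < 1 := by rw [hρ, div_lt_one (by positivity)]; linarith
  have e₀ : (edgeProd n w₀ univ : ℝ) * ρ ^ edgeSum n w₀ univ
      = ∏ p ∈ (univ : Finset (Fin n)).powersetCard 2, ((a : ℝ) * ρ ^ a) := by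
    rw [edgeProd_mul_pow]
    exact prod_congr rfl fun p hp =>
      (mul_pow_le_and_eq ha _).2.2 (h₀ p (mem_powersetCard.1 hp).2)
  have hprod : (edgeProd n w univ : ℝ) * ρ ^ edgeSum n w univ
      ≤ (edgeProd n w₀ univ : ℝ) * ρ ^ edgeSum n w₀ univ := by
    rw [e₀, edgeProd_mul_pow]
    exact prod_le_prod (fun p _ => by positivity) fun p _ => (mul_pow_le_and_eq ha _).1
  have hpow : ρ ^ edgeSum n w₀ univ ≤ ρ ^ edgeSum n w univ :=
    pow_le_pow_of_le_one hρ0.le hρ1.le hle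
  have hmain : (edgeProd n w univ : ℝ) * ρ ^ edgeSum n w₀ univ
      ≤ (edgeProd n w univ : ℝ) * ρ ^ edgeSum n w univ :=
    mul_le_mul_of_nonneg_left hpow (by positivity)
  refine ⟨?_, fun heq => ?_⟩
  · exact_mod_cast le_of_mul_le_mul_right (hmain.trans hprod) (by positivity)
  have hpos₀ : (0 : ℝ) < edgeProd n w₀ univ := by
    have : 0 < edgeProd n w₀ univ := prod_pos fun p hp => by
      rcases h₀ p (mem_powersetCard.1 hp).2 with h | h <;> omega
    exact_mod_cast this
  rw [heq] at hmain hprod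
  have hpoweq : ρ ^ edgeSum n w univ = ρ ^ edgeSum n w₀ univ :=
    le_antisymm (le_of_mul_le_mul_left hprod hpos₀) hpow
  have hsum : edgeSum n w univ = edgeSum n w₀ univ :=
    (pow_right_strictAnti₀ hρ0 hρ1).injective hpoweq
  refine ⟨hsum, fun p hp => ?_⟩
  have hwpos : ∀ q ∈ (univ : Finset (Fin n)).powersetCard 2, 0 < w q := by
    intro q hq
    rw [Nat.pos_iff_ne_zero]
    intro h0
    have : edgeProd n w univ = 0 := prod_eq_zero hq h0
    rw [← heq, this] at hpos₀
    simp at hpos₀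
  by_contra hne
  have hlt : ∏ p ∈ univ.powersetCard 2, ((w p : ℝ) * ρ ^ w p)
      < ∏ p ∈ (univ : Finset (Fin n)).powersetCard 2, ((a : ℝ) * ρ ^ a) := by
    refine prod_lt_prod (fun q hq => ?_) (fun q _ => (mul_pow_le_and_eq ha _).1)
      ⟨p, mem_powersetCard.2 ⟨subset_univ _, hp⟩,
        lt_of_le_of_ne (mul_pow_le_and_eq ha _).1 fun h => hne ((mul_pow_le_and_eq ha _).2.1 h)⟩
    have : (0 : ℝ) < w q := by exact_mod_cast hwpos q hq
    positivity
  rw [← edgeProd_mul_pow, ← e₀, heq, hsum] at hlt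
  exact lt_irrefl _ hlt

/-- A multigraph with multiplicities `a` and `a + 1`, as many edges as the Turán multigraph and
no `(r + 1)`-set all of whose pairs have multiplicity `a + 1` belongs to `T_{r,0}(a,n)`. -/
lemma inT_of_pairSum_le {n r a : ℕ} (hr : 1 ≤ r) {w : Finset (Fin n) → ℕ}
    (hw : ∀ p : Finset (Fin n), p.card = 2 → w p = a ∨ w p = a + 1)
    (hsum : pairSum (excess a w) univ = turanNum r n)
    (hfree : ∀ X : Finset (Fin n), X.card = r + 1 →
      pairSum (excess a w) X ≤ turanNum r (r + 1)) : InT n r 0 a w := by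
  classical
  let G : SimpleGraph (Fin n) :=
    { Adj := fun u v => u ≠ v ∧ w {u, v} = a + 1
      symm := ⟨fun u v h => ⟨h.1.symm, by rw [pair_comm]; exact h.2⟩⟩
      loopless := ⟨fun u h => h.1 rfl⟩ }
  have hcf : G.CliqueFree (r + 1) := by
    intro X hX
    have h1 := hfree X hX.card_eq
    have h2 : pairSum (excess a w) X = ∑ p ∈ X.powersetCard 2, 1 := by
      refine sum_congr rfl fun p hp => ?_
      obtain ⟨hpX, hp2⟩ := mem_powersetCard.1 hp
      obtain ⟨u, v, huv, rfl⟩ := card_eq_two.1 hp2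
      have := (hX.isClique (hpX (by simp) : u ∈ X) (hpX (by simp) : v ∈ X) huv).2
      simp [excess, this]
    rw [h2, turanNum_add_one_self hr, sum_const, card_powersetCard, hX.card_eq] at h1
    simp at h1
  have hcard : (G.edgeFinset.card : ℤ) = turanNum r n := by
    have h := G.sum_degrees_eq_twice_card_edges
    zify at h
    have h2 := sum_sum_erase (excess a w) univ
    have h3 : ∀ v, (G.degree v : ℤ) = ∑ u ∈ univ.erase v, excess a w {v, u} := by
      intro v
      rw [← SimpleGraph.card_neighborFinset_eq_degree, SimpleGraph.neighborFinset_eq_filter,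
        card_filter, ← add_sum_erase univ _ (mem_univ v), if_neg G.irrefl, zero_add]
      push_cast
      refine sum_congr rfl fun u hu => ?_
      have huv : v ≠ u := (ne_of_mem_erase hu).symm
      rcases hw {v, u} (card_pair huv) with h | h
      · rw [if_neg (fun hG => by have := hG.2; omega)]
        simp [excess, h]
      · rw [if_pos ⟨huv, h⟩]
        simp [excess, h]
    simp_rw [h3] at h
    rw [h2, hsum] at h
    linarith
  have hmax : G.IsTuranMaximal r := by
    refine ⟨hcf, fun H _ hH => ?_⟩
    have h1 := (SimpleGraph.isTuranMaximal_turanGraph (n := n) hr).2 hH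
    have h2 := card_edgeFinset_turanGraph_eq (n := n) hr
    have : H.edgeFinset.card ≤ G.edgeFinset.card := by
      zify at h1 ⊢
      rw [hcard, ← h2]
      exact h1
    exact this
  obtain ⟨φ⟩ := hmax.nonempty_iso_turanGraph
  refine ⟨fun v => φ v % r, fun v => Nat.mod_lt _ hr, fun u v huv => ?_⟩
  have hadj : (φ u : ℕ) % r ≠ φ v % r ↔ w {u, v} = a + 1 := by
    rw [← SimpleGraph.turanGraph_adj, φ.map_adj_iff]
    exact ⟨fun h => h.2, fun h => ⟨huv, h⟩⟩
  by_cases h : (φ u : ℕ) % r = φ v % r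
  · rw [if_pos h, tsub_zero, ite_self]
    exact (hw _ (card_pair huv)).resolve_right fun h' => hadj.2 h' h
  · rw [if_neg h]
    exact hadj.1 h

lemma isF_iff_pairSum_le {n r s a : ℕ} (hr : 1 ≤ r) (hs : r + 1 ≤ s) (w : Finset (Fin n) → ℕ) :
    IsF n s (SigmaT r 0 a s) w ↔
      ∀ X : Finset (Fin n), X.card = s → pairSum (excess a w) X ≤ turanNum r s := by
  refine forall₂_congr fun X hX => ?_
  zify
  rw [edgeSum_eq a, sigmaT_eq hr hs, hX]
  exact add_le_add_iff_left _

/-- An extremal multigraph in `F(n,s,Σ_{r,0}(a,s))` spans few edges on every `(r + 1)`-set. -/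
lemma pairSum_le_turanNum_descend {n r s : ℕ} (hr : 1 ≤ r) (hs : r + 1 ≤ s)
    (hn : 2 * r * (s + 2) ≤ n) (g : Finset (Fin n) → ℤ) (hg : pairSum g univ = turanNum r n)
    (h : ∀ X : Finset (Fin n), X.card = s → pairSum g X ≤ turanNum r s) :
    ∀ X : Finset (Fin n), X.card = r + 1 → pairSum g X ≤ turanNum r (r + 1) := by
  have hsn : s + 1 ≤ n := by nlinarith
  obtain ⟨N, rfl⟩ : ∃ N, n = N + 1 := ⟨n - 1, by omega⟩
  have hdeg : ∀ v : Fin (N + 1), (Fintype.card (Fin (N + 1)) : ℤ) - 1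
      - ((Fintype.card (Fin (N + 1)) - 1) / r : ℕ) ≤ ∑ u ∈ univ.erase v, g {v, u} := by
    intro v
    have h1 := pairSum_erase g (mem_univ v)
    have h2 := pairSum_le_turanNum hr hs g h (m := N) (by omega) (univ.erase v)
      (by rw [card_erase_of_mem (mem_univ v)]; simp)
    rw [hg, turanNum_succ] at h1
    rw [Fintype.card_fin, Nat.add_sub_cancel]
    push_cast at h1 ⊢
    linarith
  suffices H : ∀ m ≤ s, r + 1 ≤ m → ∀ X : Finset (Fin (N + 1)), X.card = m →
      pairSum g X ≤ turanNum r m from H (r + 1) hs le_rfl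
  intro m hm
  induction hm using Nat.decreasingInduction with
  | self => exact fun _ => h
  | of_succ k hk ih =>
    intro hk1 X hX
    refine pairSum_le_turanNum_of_succ hr g ?_ hdeg (ih (by omega)) X hX
    rw [Fintype.card_fin]
    nlinarith

/-- Multigraph Turán theorem: for all `a, r, s ∈ ℕ` (with `a, r ≥ 1`) such that
`s ≥ r + 1`, and all `n ≥ 2r(s+2) + r(s+2)√(s-1)`, one has
`ex_Π(n, s, Σ_{r,0}(a,s)) = Π_{r,0}(a,n)`; moreover the product-extremal members of
`F(n, s, Σ_{r,0}(a,s))` are exactly the product-maximal members of `T_{r,0}(a,n)`. -/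
theorem multigraph_turan (a r s : ℕ) (ha : 1 ≤ a) (hr : 1 ≤ r) (hs : r + 1 ≤ s)
    (n : ℕ)
    (hn : 2 * (r : ℝ) * ((s : ℝ) + 2) + (r : ℝ) * ((s : ℝ) + 2) * Real.sqrt ((s : ℝ) - 1)
      ≤ (n : ℝ)) :
    exPi n s (SigmaT r 0 a s) = PiT r 0 a n ∧
    ∀ w : Finset (Fin n) → ℕ,
      ((IsF n s (SigmaT r 0 a s) w ∧ edgeProd n w Finset.univ = PiT r 0 a n) ↔
        (InT n r 0 a w ∧ edgeProd n w Finset.univ = PiT r 0 a n)) := by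
  have hn' : 2 * r * (s + 2) ≤ n := by
    have h0 : 0 ≤ (r : ℝ) * ((s : ℝ) + 2) * Real.sqrt ((s : ℝ) - 1) := by positivity
    have : ((2 * r * (s + 2) : ℕ) : ℝ) ≤ n := by
      push_cast
      linarith
    exact_mod_cast this
  have hsn : s ≤ n := by nlinarith
  have hrn : r + 1 ≤ n := hs.trans hsn
  have hcard : (univ : Finset (Fin n)).card = n := by simp
  have hT : ∀ {w : Finset (Fin n) → ℕ}, InT n r 0 a w → IsF n s (SigmaT r 0 a s) w :=
    fun hw => (isF_iff_pairSum_le hr hs _).2 (hw.pairSum_le hr hs)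
  have hT₀ := inT_turanMultigraph (n := n) hr a
  have hsum : ∀ {w : Finset (Fin n) → ℕ}, IsF n s (SigmaT r 0 a s) w →
      edgeSum n w univ ≤ edgeSum n (turanMultigraph n r a) univ := by
    intro w hw
    zify
    rw [edgeSum_eq a, edgeSum_eq a, pairSum_turanMultigraph hr]
    have := pairSum_le_turanNum hr hs _ ((isF_iff_pairSum_le hr hs w).1 hw) hsn univ hcard
    linarith
  have hle : ∀ {w : Finset (Fin n) → ℕ} (hw : IsF n s (SigmaT r 0 a s) w), _ :=
    fun hw => edgeProd_le_of_edgeSum_le ha (fun p hp => hT₀.eq_or_eq hp) (hsum hw)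
  have hex : exPi n s (SigmaT r 0 a s) = edgeProd n (turanMultigraph n r a) univ :=
    IsGreatest.csSup_eq ⟨⟨_, hT hT₀, rfl⟩, by rintro _ ⟨w, hw, rfl⟩; exact (hle hw).1⟩
  have hPi : PiT r 0 a n = edgeProd n (turanMultigraph n r a) univ :=
    IsGreatest.csSup_eq ⟨⟨_, hT₀, rfl⟩, by rintro _ ⟨w, hw, rfl⟩; exact (hle (hT hw)).1⟩
  refine ⟨hex.trans hPi.symm, fun w => ⟨fun ⟨hw, hP⟩ => ⟨?_, hP⟩, fun ⟨hw, hP⟩ => ⟨hT hw, hP⟩⟩⟩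
  obtain ⟨he, hval⟩ := (hle hw).2 (hP.trans hPi)
  have hg : pairSum (excess a w) univ = turanNum r n := by
    zify at he
    rw [edgeSum_eq a, edgeSum_eq a, pairSum_turanMultigraph hr] at he
    linarith
  exact inT_of_pairSum_le hr hval hg
    (pairSum_le_turanNum_descend hr hs hn' _ hg ((isF_iff_pairSum_le hr hs w).1 hw))
end

section
/- Sparse case at q = C(s,2) + s − 1: for every integer s ≥ 2 and every integer n ≥ s, ex_Π(n, s, C(s,2) + s − 1) = 2^{ex(n, {C₃, C₄, …, C_s})}, where ex(n, {C₃, …, C_s}) is the maximum number of edges in a simple graph on n vertices containing no cycle of length at most s (i.e. with girth at least s+1). -/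
open Finset

/-- `ex(n, {C₃, C₄, …, C_s})`: the maximum number of edges in a simple graph on `n`
vertices containing no cycle of length `ℓ` for any `3 ≤ ℓ ≤ s`. -/
noncomputable def exCycles (n s : ℕ) : ℕ :=
  sSup {m | ∃ G : SimpleGraph (Fin n),
    (∀ (v : Fin n) (c : G.Walk v v), c.IsCycle → ¬(3 ≤ c.length ∧ c.length ≤ s)) ∧
    m = G.edgeSet.ncard}

section EdgeSum

variable {n : ℕ} (w : Finset (Fin n) → ℕ)

theorem edgeSum_insert {X : Finset (Fin n)} {v : Fin n} (hv : v ∉ X) :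
    edgeSum n w (insert v X) = edgeSum n w X + ∑ u ∈ X, w {u, v} := by
  unfold edgeSum
  rw [powersetCard_succ_insert hv, sum_union, sum_image]
  · congr 1
    rw [powersetCard_one, sum_map]
    exact sum_congr rfl fun u _ ↦ by simp [pair_comm]
  · intro a ha b hb hab
    have ha' : v ∉ a := fun h ↦ hv ((mem_powersetCard.1 ha).1 h)
    have hb' : v ∉ b := fun h ↦ hv ((mem_powersetCard.1 hb).1 h)
    rw [← erase_insert ha', hab, erase_insert hb']
  · rw [disjoint_left]
    intro p hp hp'
    obtain ⟨q, -, rfl⟩ := mem_image.1 hp'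
    exact hv ((mem_powersetCard.1 hp).1 (mem_insert_self v q))

theorem edgeSum_singleton (v : Fin n) : edgeSum n w {v} = 0 := by
  simp [edgeSum, powersetCard_eq_empty.2]

theorem edgeSum_congr {w' : Finset (Fin n) → ℕ} {X : Finset (Fin n)}
    (h : ∀ p ⊆ X, w p = w' p) : edgeSum n w X = edgeSum n w' X :=
  sum_congr rfl fun p hp ↦ h p (mem_powersetCard.1 hp).1

theorem sum_sum_erase_eq_two_mul_edgeSum (X : Finset (Fin n)) :
    ∑ u ∈ X, ∑ v ∈ X.erase u, w {v, u} = 2 * edgeSum n w X := by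
  induction X using Finset.induction_on with
  | empty => simp [edgeSum]
  | insert a X ha ih =>
    have h : ∀ u ∈ X, ∑ v ∈ (insert a X).erase u, w {v, u} =
        w {u, a} + ∑ v ∈ X.erase u, w {v, u} := by
      intro u hu
      have hua : a ≠ u := fun h ↦ ha (h ▸ hu)
      rw [erase_insert_of_ne hua, sum_insert (fun h ↦ ha (mem_of_mem_erase h)), pair_comm]
    rw [sum_insert ha, erase_insert ha, sum_congr rfl h, sum_add_distrib, ih,
      edgeSum_insert w ha]
    ring

/-- No edge of `w` inside `S` leaves `X`. -/
def IsClosedIn (S X : Finset (Fin n)) : Prop :=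
  X ⊆ S ∧ ∀ u ∈ X, ∀ v ∈ S \ X, w {u, v} = 0

variable {w}

theorem IsClosedIn.edgeSum_eq_add {S X : Finset (Fin n)} (h : IsClosedIn w S X) :
    edgeSum n w S = edgeSum n w X + edgeSum n w (S \ X) := by
  have key : ∀ B ⊆ S \ X, edgeSum n w (X ∪ B) = edgeSum n w X + edgeSum n w B := by
    intro B
    induction B using Finset.induction_on with
    | empty => intro _; simp [edgeSum]
    | insert b B hb ih =>
      intro hB
      rw [insert_subset_iff] at hB
      have hbX : b ∉ X := (mem_sdiff.1 hB.1).2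
      have hd : Disjoint X B := disjoint_left.2 fun x hx hx' ↦ (mem_sdiff.1 (hB.2 hx')).2 hx
      rw [union_insert, edgeSum_insert w (by simp [hb, hbX]), ih hB.2, edgeSum_insert w hb,
        sum_union hd, sum_eq_zero fun u hu ↦ h.2 u hu b hB.1]
      ring
  rw [← key _ Subset.rfl, union_sdiff_of_subset h.1]

theorem IsClosedIn.sdiff {S X Y : Finset (Fin n)} (hX : IsClosedIn w S X)
    (hY : IsClosedIn w S Y) : IsClosedIn w S (X \ Y) := by
  refine ⟨sdiff_subset.trans hX.1, fun u hu v hv ↦ ?_⟩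
  rw [mem_sdiff] at hu hv
  by_cases hvX : v ∈ X
  · have hvY : v ∈ Y := by
      by_contra h
      exact hv.2 (mem_sdiff.2 ⟨hvX, h⟩)
    rw [pair_comm]
    exact hY.2 v hvY u (mem_sdiff.2 ⟨hX.1 hu.1, hu.2⟩)
  · exact hX.2 u hu.1 v (mem_sdiff.2 ⟨hv.1, hvX⟩)

theorem IsClosedIn.mono {S X Y : Finset (Fin n)} (hX : IsClosedIn w S X) (hXY : X ⊆ Y)
    (hY : Y ⊆ S) : IsClosedIn w Y X :=
  ⟨hXY, fun u hu v hv ↦ hX.2 u hu v (sdiff_subset_sdiff hY Subset.rfl hv)⟩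

/-- If every vertex of `S` has degree at least two in `S`, a union of components of `S` spans
at least as many edges as it has vertices. -/
theorem IsClosedIn.card_le_edgeSum {S X : Finset (Fin n)} (hX : IsClosedIn w S X)
    (hdeg : ∀ v ∈ S, 2 ≤ ∑ u ∈ S.erase v, w {u, v}) : X.card ≤ edgeSum n w X := by
  have h : ∑ u ∈ X, 2 ≤ ∑ u ∈ X, ∑ v ∈ X.erase u, w {v, u} := by
    refine sum_le_sum fun u hu ↦ (hdeg u (hX.1 hu)).trans (le_of_eq ?_)
    refine (sum_subset (erase_subset_erase u hX.1) fun v hv hv' ↦ ?_).symm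
    rw [pair_comm]
    refine hX.2 u hu v (mem_sdiff.2 ⟨mem_of_mem_erase hv, fun h ↦ hv' ?_⟩)
    exact mem_erase.2 ⟨ne_of_mem_erase hv, h⟩
  rw [sum_sum_erase_eq_two_mul_edgeSum, sum_const, smul_eq_mul] at h
  omega

/-- A set of at most `s` vertices spanning many edges extends to a union of components. -/
theorem exists_isClosedIn {s : ℕ} (hw : ∀ X : Finset (Fin n), X.card = s → edgeSum n w X < s)
    (c : ℕ) {S B Y : Finset (Fin n)} (hBY : B ⊆ Y) (hYS : Y ⊆ S) (hYs : Y.card ≤ s)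
    (hY : Y.card + c ≤ edgeSum n w Y) :
    ∃ X, B ⊆ X ∧ X.card < s ∧ X.card + c ≤ edgeSum n w X ∧ IsClosedIn w S X ∧
      ∀ X' ⊆ S, B ⊆ X' → X'.card ≤ s → X'.card + c ≤ edgeSum n w X' → X'.card ≤ X.card := by
  classical
  obtain ⟨X, hX, hmax⟩ := exists_max_image
    {X ∈ S.powerset | B ⊆ X ∧ X.card ≤ s ∧ X.card + c ≤ edgeSum n w X} card
    ⟨Y, by simp [*]⟩
  simp only [mem_filter, mem_powerset] at hX hmax
  obtain ⟨hXS, hBX, hXs, hXe⟩ := hX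
  have hlt : X.card < s := by
    refine lt_of_le_of_ne hXs fun h ↦ ?_
    have := hw X h
    omega
  refine ⟨X, hBX, hlt, hXe, ⟨hXS, fun u hu v hv ↦ ?_⟩,
    fun X' h₁ h₂ h₃ h₄ ↦ hmax X' ⟨h₁, h₂, h₃, h₄⟩⟩
  by_contra h
  rw [mem_sdiff] at hv
  have hsum : w {u, v} ≤ ∑ x ∈ X, w {x, v} :=
    single_le_sum (f := fun x ↦ w {x, v}) (fun _ _ ↦ Nat.zero_le _) hu
  have hcard := card_insert_of_notMem hv.2
  have := hmax (insert v X) ⟨insert_subset hv.1 hXS, hBX.trans (subset_insert v X), by omega, by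
    rw [edgeSum_insert w hv.2]; omega⟩
  omega

theorem edgeSum_le_card_of_two_le_degree {s : ℕ}
    (hw : ∀ X : Finset (Fin n), X.card = s → edgeSum n w X < s) {S Y : Finset (Fin n)}
    (hS : s ≤ S.card) (hdeg : ∀ v ∈ S, 2 ≤ ∑ u ∈ S.erase v, w {u, v})
    (hYS : Y ⊆ S) (hYs : Y.card ≤ s) : edgeSum n w Y ≤ Y.card := by
  by_contra! h
  obtain ⟨X, -, hXs, hXe, hXc, hXmax⟩ :=
    exists_isClosedIn hw 1 (empty_subset Y) hYS hYs h
  obtain ⟨z, hzS, hzX⟩ := exists_mem_notMem_of_card_lt_card (hXs.trans_le hS)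
  have hcard := card_insert_of_notMem hzX
  have hins := edgeSum_insert w hzX
  obtain ⟨Z, hXZ, hZs, -, hZc, hZmax⟩ :=
    exists_isClosedIn hw 0 (subset_insert z X) (insert_subset hzS hXc.1) (by omega)
      (by omega)
  have h₁ := (hXc.mono hXZ hZc.1).edgeSum_eq_add
  have h₂ := (hZc.sdiff hXc).card_le_edgeSum hdeg
  have h₃ := card_sdiff_add_card_eq_card hXZ
  have h₄ := card_le_card hXZ
  have h₅ : X.card < Z.card := by
    rw [← Nat.succ_le_iff, Nat.succ_eq_add_one, ← hcard]
    exact hZmax _ (insert_subset hzS hXc.1) (subset_insert z X) (by omega) (by omega)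
  have h₆ := hXmax Z hZc.1 (empty_subset Z) hZs.le (by omega)
  omega

/-- Every nonempty set of at most `s` vertices of `S` spans fewer edges than vertices; for
simple graphs, `S` spans no cycle of length at most `s`. -/
def LocallySparse (s : ℕ) (w : Finset (Fin n) → ℕ) (S : Finset (Fin n)) : Prop :=
  ∀ X ⊆ S, X.Nonempty → X.card ≤ s → edgeSum n w X < X.card

theorem LocallySparse.exists_insert {s : ℕ} {S : Finset (Fin n)} (hw : LocallySparse s w S)
    (hS : S.Nonempty) {v : Fin n} (hv : v ∉ S) :
    ∃ w', LocallySparse s w' (insert v S) ∧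
      edgeSum n w' (insert v S) = edgeSum n w S + 1 := by
  classical
  obtain ⟨u, hu⟩ := hS
  let w' : Finset (Fin n) → ℕ := fun p ↦ if v ∈ p then (if p = {u, v} then 1 else 0) else w p
  have hE : ∀ X : Finset (Fin n), v ∉ X → edgeSum n w' X = edgeSum n w X := fun X hX ↦
    edgeSum_congr w' fun p hp ↦ by
      have : v ∉ p := fun h ↦ hX (hp h)
      simp [w', this]
  have hd : ∀ x, x ≠ v → w' {x, v} = if x = u then 1 else 0 := by
    intro x hx
    have : ({x, v} : Finset (Fin n)) = {u, v} ↔ x = u := by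
      refine ⟨fun h ↦ ?_, fun h ↦ by rw [h]⟩
      have : x ∈ ({u, v} : Finset (Fin n)) := h ▸ mem_insert_self x {v}
      simpa [hx] using this
    simp [w', this]
  have hs : ∀ X : Finset (Fin n), v ∉ X →
      ∑ x ∈ X, w' {x, v} = if u ∈ X then 1 else 0 := by
    intro X hX
    rw [sum_congr rfl fun x hx ↦ hd x fun h ↦ hX (h ▸ hx)]
    simp
  refine ⟨w', fun X hX hne hXs ↦ ?_, by rw [edgeSum_insert w' hv, hE S hv, hs S hv, if_pos hu]⟩
  by_cases hvX : v ∈ X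
  · obtain ⟨Z, hvZ, rfl⟩ : ∃ Z, v ∉ Z ∧ insert v Z = X :=
      ⟨X.erase v, notMem_erase v X, insert_erase hvX⟩
    have hZS : Z ⊆ S := (insert_subset_insert_iff hvZ).1 hX
    rw [card_insert_of_notMem hvZ] at hXs ⊢
    rw [edgeSum_insert w' hvZ, hE Z hvZ, hs Z hvZ]
    rcases Z.eq_empty_or_nonempty with rfl | hZ
    · simp [edgeSum]
    · have := hw Z hZS hZ (by omega)
      split_ifs <;> omega
  · rw [hE X hvX]
    exact hw X ((subset_insert_iff_of_notMem hvX).1 hX) hne hXs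

theorem LocallySparse.exists_extend {s : ℕ} {S T : Finset (Fin n)} (hw : LocallySparse s w S)
    (hS : S.Nonempty) (hST : S ⊆ T) :
    ∃ w', LocallySparse s w' T ∧ edgeSum n w' T = edgeSum n w S + (T \ S).card := by
  have key : ∀ B : Finset (Fin n), Disjoint B S → ∃ w', LocallySparse s w' (B ∪ S) ∧
      edgeSum n w' (B ∪ S) = edgeSum n w S + B.card := by
    intro B
    induction B using Finset.induction_on with
    | empty => intro _; exact ⟨w, by simpa using hw, by simp⟩
    | insert b B hb ih =>
      intro hB
      rw [disjoint_insert_left] at hB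
      obtain ⟨w₁, h₁, h₂⟩ := ih hB.2
      obtain ⟨w₂, h₃, h₄⟩ := h₁.exists_insert (hS.mono subset_union_right)
        (v := b) (by simp [hb, hB.1])
      refine ⟨w₂, by rwa [insert_union], ?_⟩
      rw [insert_union, h₄, h₂, card_insert_of_notMem hb, add_assoc]
  simpa [sdiff_union_of_subset hST] using key (T \ S) disjoint_sdiff_self_left

theorem exists_locallySparse_tree (s : ℕ) {S : Finset (Fin n)} (hS : S.Nonempty) :
    ∃ w, LocallySparse s w S ∧ edgeSum n w S = S.card - 1 := by
  obtain ⟨v, hv⟩ := hS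
  have h0 : LocallySparse s (0 : Finset (Fin n) → ℕ) {v} := fun X _ hne _ ↦ by
    simpa [edgeSum] using hne.card_pos
  obtain ⟨w, h₁, h₂⟩ := h0.exists_extend (singleton_nonempty v) (singleton_subset_iff.2 hv)
  refine ⟨w, h₁, ?_⟩
  rw [h₂, edgeSum_singleton, card_sdiff_of_subset (singleton_subset_iff.2 hv), card_singleton,
    zero_add]

open scoped Fin.NatCast Fin.CommRing in
theorem exists_locallySparse_cycle {s : ℕ} (hs : 1 ≤ s) {S : Finset (Fin n)}
    (hS : s < S.card) : ∃ w, LocallySparse s w S ∧ edgeSum n w S = S.card := by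
  classical
  obtain ⟨k, hk⟩ : ∃ k, S.card = k + 1 := ⟨S.card - 1, by omega⟩
  let e := S.equivFinOfCardEq hk
  let f : Fin (k + 1) → Fin n := fun i ↦ e.symm i
  have hf : Function.Injective f := Subtype.val_injective.comp e.symm.injective
  have hfS : ∀ i, f i ∈ S := fun i ↦ (e.symm i).2
  have hne : ∀ i, f i ≠ f (i + 1) := fun i h ↦ by
    have h1 : (1 : Fin (k + 1)) = 0 := by simpa using (hf h).symm
    have : k + 1 = 1 := Fin.one_eq_zero_iff.1 h1
    omega
  let w : Finset (Fin n) → ℕ := fun p ↦ ∑ i, if p = {f i, f (i + 1)} then 1 else 0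
  have hE : ∀ X, edgeSum n w X = #{i | f i ∈ X ∧ f (i + 1) ∈ X} := by
    intro X
    unfold edgeSum
    rw [sum_comm, card_filter]
    refine sum_congr rfl fun i _ ↦ ?_
    rw [sum_ite_eq']
    simp [mem_powersetCard, insert_subset_iff, card_pair (hne i)]
  refine ⟨w, fun X hXS hX hXs ↦ ?_, by rw [hE, hk]; simp [hfS]⟩
  have hT : #{i | f i ∈ X} ≤ X.card :=
    card_le_card_of_injOn f (by intro i; simp) hf.injOn
  rw [hE]
  refine lt_of_lt_of_le (card_lt_card ?_) hT
  refine ⟨fun i ↦ by simp +contextual, fun hsub ↦ ?_⟩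
  obtain ⟨x, hx⟩ := hX
  have hstep : ∀ i, f i ∈ X → f (i + 1) ∈ X := fun i hi ↦ by
    have := hsub (x := i) (by simpa using hi)
    simp only [mem_filter] at this
    exact this.2.2
  let a := e ⟨x, hXS hx⟩
  have ha : f a ∈ X := by simpa [f, a] using hx
  have hall : ∀ j : ℕ, f (a + (j : Fin (k + 1))) ∈ X := by
    intro j
    induction j with
    | zero => simpa using ha
    | succ j ih => simpa [add_assoc] using hstep _ ih
  have huniv : ∀ b, f b ∈ X := fun b ↦ by
    simpa using hall (b - a).val
  have := card_le_card_of_injOn (s := univ) (t := X) f (fun i _ ↦ huniv i) hf.injOn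
  rw [card_univ, Fintype.card_fin] at this
  omega

/-- A multigraph all of whose `s`-sets span fewer than `s` edges has at most as many edges as
some locally sparse one. -/
theorem exists_locallySparse_edgeSum_le {s : ℕ} (hs : 1 ≤ s)
    (hw : ∀ X : Finset (Fin n), X.card = s → edgeSum n w X < s) (S : Finset (Fin n))
    (hS : s ≤ S.card) :
    ∃ w', LocallySparse s w' S ∧ edgeSum n w S ≤ edgeSum n w' S := by
  induction S using Finset.strongInduction with
  | H S ih =>
  rcases hS.eq_or_lt with hS' | hS'
  · obtain ⟨w', h₁, h₂⟩ := exists_locallySparse_tree s (S := S) (card_pos.1 (by omega))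
    have := hw S hS'.symm
    exact ⟨w', h₁, by omega⟩
  by_cases hdeg : ∀ v ∈ S, 2 ≤ ∑ u ∈ S.erase v, w {u, v}
  swap
  · push Not at hdeg
    obtain ⟨v, hv, hlt⟩ := hdeg
    have hcard := card_erase_add_one hv
    obtain ⟨w₁, h₁, h₂⟩ := ih (S.erase v) (erase_ssubset hv) (by omega)
    obtain ⟨w₂, h₃, h₄⟩ := h₁.exists_insert (card_pos.1 (by omega)) (notMem_erase v S)
    have h₅ := edgeSum_insert w (notMem_erase v S)
    rw [insert_erase hv] at h₃ h₄ h₅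
    exact ⟨w₂, h₃, by omega⟩
  rcases le_or_gt (edgeSum n w S) S.card with hle | hgt
  · obtain ⟨w', h₁, h₂⟩ := exists_locallySparse_cycle hs hS'
    exact ⟨w', h₁, by omega⟩
  by_cases hsp : LocallySparse s w S
  · exact ⟨w, hsp, le_rfl⟩
  unfold LocallySparse at hsp
  push Not at hsp
  obtain ⟨Y, hYS, hYne, hYs, hY⟩ := hsp
  obtain ⟨X, -, hXs, hXe, hXc, hXmax⟩ := exists_isClosedIn hw 0 (empty_subset Y) hYS hYs hY
  have hYX := hXmax Y hYS (empty_subset Y) hYs hY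
  have hYpos := hYne.card_pos
  have hXle := edgeSum_le_card_of_two_le_degree hw hS hdeg hXc.1 hXs.le
  have hsplit := hXc.edgeSum_eq_add
  have hcard := card_sdiff_add_card_eq_card hXc.1
  rcases le_or_gt s (S \ X).card with hR | hR
  · obtain ⟨w₁, h₁, h₂⟩ := ih (S \ X)
      (sdiff_ssubset hXc.1 (card_pos.1 (by omega))) hR
    obtain ⟨w₂, h₃, h₄⟩ := h₁.exists_extend (card_pos.1 (by omega)) (sdiff_subset (s := S))
    rw [Finset.sdiff_sdiff_eq_self hXc.1] at h₄
    exact ⟨w₂, h₃, by omega⟩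
  · have := edgeSum_le_card_of_two_le_degree hw hS hdeg (sdiff_subset (s := S) (t := X)) hR.le
    omega

end EdgeSum

section Girth

variable {n : ℕ}

theorem card_edgeSet_lt_of_isAcyclic {V : Type*} [Fintype V] [Nonempty V] {G : SimpleGraph V}
    (hG : G.IsAcyclic) : G.edgeSet.ncard < Fintype.card V := by
  classical
  obtain ⟨T, hGT, -, hT⟩ : ∃ T, G ≤ T ∧ T ≤ ⊤ ∧ T.IsTree := by
    obtain ⟨T, h₁, h₂⟩ :=
      SimpleGraph.exists_maximal_isAcyclic_of_le_isAcyclic (G := ⊤) le_top hG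
    refine ⟨T, h₁, le_top, SimpleGraph.maximal_isAcyclic_iff_isTree.1 ?_⟩
    simpa using h₂
  have h := hT.card_edgeFinset
  have h' : G.edgeSet.ncard ≤ T.edgeSet.ncard :=
    Set.ncard_le_ncard (SimpleGraph.edgeSet_mono hGT) (Set.toFinite _)
  rw [← SimpleGraph.coe_edgeFinset T, Set.ncard_coe_finset] at h'
  omega

theorem sym2_toFinset_injective {α : Type*} [DecidableEq α] :
    Function.Injective (Sym2.toFinset : Sym2 α → Finset α) := fun a b h ↦
  Sym2.ext fun x ↦ by rw [← Sym2.mem_toFinset, h, Sym2.mem_toFinset]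

/-- The pairs of vertices in `X` adjacent in `G`, as two-element sets. -/
noncomputable def edgePairs (G : SimpleGraph (Fin n)) (X : Finset (Fin n)) :
    Finset (Finset (Fin n)) :=
  open Classical in {p ∈ X.powersetCard 2 | ∃ e ∈ G.edgeSet, e.toFinset = p}

theorem card_edgePairs_univ (G : SimpleGraph (Fin n)) :
    (edgePairs G univ).card = G.edgeSet.ncard := by
  classical
  have : (edgePairs G univ : Set (Finset (Fin n))) = Sym2.toFinset '' G.edgeSet := by
    ext p
    simp only [edgePairs, coe_filter, Set.mem_ofPred_eq, Set.mem_image, mem_powersetCard,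
      subset_univ, true_and, and_iff_right_iff_imp]
    rintro ⟨e, he, rfl⟩
    exact Sym2.card_toFinset_of_not_isDiag e (G.not_isDiag_of_mem_edgeSet he)
  rw [← Set.ncard_coe_finset, this, Set.ncard_image_of_injective _ sym2_toFinset_injective]

theorem card_edgePairs_lt {G : SimpleGraph (Fin n)} {X : Finset (Fin n)} (hX : X.Nonempty)
    (hG : ∀ (v : Fin n) (c : G.Walk v v), c.IsCycle → ¬(3 ≤ c.length ∧ c.length ≤ X.card)) :
    (edgePairs G X).card < X.card := by
  classical
  have : Nonempty (X : Set (Fin n)) := hX.to_subtype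
  have hac : (G.induce (X : Set (Fin n))).IsAcyclic := by
    intro v c hc
    have hinj := (SimpleGraph.Embedding.induce (G := G) (X : Set (Fin n))).injective
    refine hG _ (c.map (SimpleGraph.Embedding.induce (X : Set (Fin n))).toHom)
      (hc.map hinj) ⟨?_, ?_⟩
    · rw [SimpleGraph.Walk.length_map]
      exact hc.three_le_length
    · have h := hc.support_nodup.length_le_card
      rw [SimpleGraph.Walk.length_map]
      simpa using h
  have hlt := card_edgeSet_lt_of_isAcyclic hac
  have hsub : edgePairs G X ⊆ (G.induce (X : Set (Fin n))).edgeFinset.image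
      (fun e ↦ (e.map Subtype.val).toFinset) := by
    intro p hp
    simp only [edgePairs, mem_filter, mem_powersetCard] at hp
    obtain ⟨⟨hpX, -⟩, e, he, rfl⟩ := hp
    induction e using Sym2.ind with
    | _ x y =>
    rw [Sym2.toFinset_mk_eq] at hpX
    have hx : x ∈ X := hpX (by simp)
    have hy : y ∈ X := hpX (by simp)
    exact mem_image.2 ⟨s(⟨x, hx⟩, ⟨y, hy⟩), by simpa using he, by simp⟩
  have h := (card_le_card hsub).trans card_image_le
  rw [← Set.ncard_coe_finset, ← Set.ncard_coe_finset, SimpleGraph.coe_edgeFinset] at h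
  rw [Set.ncard_coe_finset] at h
  simp at hlt
  omega

theorem LocallySparse.exists_simpleGraph {s : ℕ} (hs : 2 ≤ s) {w : Finset (Fin n) → ℕ}
    (hw : LocallySparse s w univ) :
    ∃ G : SimpleGraph (Fin n),
      (∀ (v : Fin n) (c : G.Walk v v), c.IsCycle → ¬(3 ≤ c.length ∧ c.length ≤ s)) ∧
      edgeSum n w univ ≤ G.edgeSet.ncard := by
  classical
  let G : SimpleGraph (Fin n) :=
    { Adj := fun u v ↦ u ≠ v ∧ w {u, v} ≠ 0
      symm := ⟨fun u v h ↦ ⟨h.1.symm, by rw [pair_comm]; exact h.2⟩⟩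
      loopless := ⟨fun u h ↦ h.1 rfl⟩ }
  have hG : ∀ e ∈ G.edgeSet, w e.toFinset ≠ 0 ∧ e.toFinset.card = 2 := by
    intro e he
    refine ⟨?_, Sym2.card_toFinset_of_not_isDiag e (G.not_isDiag_of_mem_edgeSet he)⟩
    induction e using Sym2.ind with
    | _ x y =>
    rw [Sym2.toFinset_mk_eq]
    exact (G.mem_edgeSet.1 he).2
  refine ⟨G, fun v c hc hlen ↦ ?_, ?_⟩
  · let X := c.support.toFinset
    have hXlen : X.card ≤ c.length := by
      have h : X ⊆ c.support.tail.toFinset := by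
        intro x hx
        rw [List.mem_toFinset] at hx ⊢
        rw [SimpleGraph.Walk.mem_support_iff] at hx
        rcases hx with rfl | hx
        · exact c.end_mem_tail_support hc.not_nil
        · exact hx
      refine (card_le_card h).trans ((List.toFinset_card_le _).trans ?_)
      simp
    have h := hw X (subset_univ X) ⟨v, by simp [X]⟩ (hXlen.trans hlen.2)
    have hsub : c.edges.toFinset.image Sym2.toFinset ⊆ X.powersetCard 2 := by
      intro p hp
      obtain ⟨e, he, rfl⟩ := mem_image.1 hp
      rw [List.mem_toFinset] at he
      refine mem_powersetCard.2 ⟨fun x hx ↦ ?_, (hG e (c.edges_subset_edgeSet he)).2⟩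
      exact List.mem_toFinset.2
        (SimpleGraph.Walk.mem_support_of_mem_edges he (Sym2.mem_toFinset.1 hx))
    have hle : c.length ≤ edgeSum n w X := calc
      c.length = (c.edges.toFinset.image Sym2.toFinset).card := by
        rw [card_image_of_injective _ sym2_toFinset_injective,
          List.toFinset_card_of_nodup hc.edges_nodup, c.length_edges]
      _ = ∑ p ∈ c.edges.toFinset.image Sym2.toFinset, 1 := by simp
      _ ≤ ∑ p ∈ c.edges.toFinset.image Sym2.toFinset, w p := by
        refine sum_le_sum fun p hp ↦ ?_
        obtain ⟨e, he, rfl⟩ := mem_image.1 hp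
        exact Nat.one_le_iff_ne_zero.2
          (hG e (c.edges_subset_edgeSet (List.mem_toFinset.1 he))).1
      _ ≤ edgeSum n w X := sum_le_sum_of_subset hsub
    omega
  · rw [← card_edgePairs_univ, edgePairs, card_filter]
    refine sum_le_sum fun p hp ↦ ?_
    have hp2 := (mem_powersetCard.1 hp).2
    have h := hw p (subset_univ p) (card_pos.1 (by omega)) (by omega)
    have h1 : edgeSum n w p = w p := by
      unfold edgeSum
      rw [← hp2, powersetCard_self, sum_singleton]
    split_ifs with hif
    · omega
    · rw [Nat.le_zero]
      by_contra hne
      obtain ⟨x, y, hxy, rfl⟩ := card_eq_two.1 hp2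
      exact hif ⟨s(x, y), G.mem_edgeSet.2 ⟨hxy, hne⟩, Sym2.toFinset_mk_eq⟩

theorem bddAbove_edgeSet_ncard (P : SimpleGraph (Fin n) → Prop) :
    BddAbove {m | ∃ G : SimpleGraph (Fin n), P G ∧ m = G.edgeSet.ncard} := by
  refine ⟨(univ : Finset (Sym2 (Fin n))).card, ?_⟩
  rintro m ⟨G, -, rfl⟩
  rw [← Set.ncard_coe_finset]
  exact Set.ncard_le_ncard (by simp) (Set.toFinite _)

theorem edgeProd_le_two_pow_exCycles {s : ℕ} (hs : 2 ≤ s) (hn : s ≤ n)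
    {w : Finset (Fin n) → ℕ} (hw : IsF n s (s.choose 2 + s - 1) w) :
    edgeProd n w univ ≤ 2 ^ exCycles n s := by
  by_cases h0 : ∃ p ∈ (univ : Finset (Fin n)).powersetCard 2, w p = 0
  · obtain ⟨p, hp, hp0⟩ := h0
    rw [edgeProd, prod_eq_zero hp hp0]
    exact Nat.zero_le _
  push Not at h0
  let x : Finset (Fin n) → ℕ := fun p ↦ w p - 1
  have hx : ∀ X : Finset (Fin n), X.card = s → edgeSum n x X < s := by
    intro X hX
    have h := hw X hX
    have h' : edgeSum n w X = edgeSum n x X + s.choose 2 := by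
      rw [← hX, ← card_powersetCard, card_eq_sum_ones, edgeSum, edgeSum, ← sum_add_distrib]
      refine sum_congr rfl fun p hp ↦ ?_
      have := h0 p (powersetCard_mono (subset_univ X) hp)
      simp only [x]
      omega
    omega
  obtain ⟨y, hy, hxy⟩ := exists_locallySparse_edgeSum_le (by omega) hx univ (by simpa using hn)
  obtain ⟨G, hG, hyG⟩ := hy.exists_simpleGraph hs
  have hGex : G.edgeSet.ncard ≤ exCycles n s :=
    le_csSup (bddAbove_edgeSet_ncard _) ⟨G, hG, rfl⟩
  calc edgeProd n w univ ≤ ∏ p ∈ (univ : Finset (Fin n)).powersetCard 2, 2 ^ x p := by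
        refine prod_le_prod' fun p _ ↦ ?_
        have := (x p).lt_two_pow_self
        simp only [x] at this ⊢
        omega
    _ = 2 ^ edgeSum n x univ := prod_pow_eq_pow_sum _ _ _
    _ ≤ 2 ^ exCycles n s := Nat.pow_le_pow_right (by norm_num) (by omega)

theorem exists_isF_edgeProd_eq_two_pow {s : ℕ} (hs : 2 ≤ s) {G : SimpleGraph (Fin n)}
    (hG : ∀ (v : Fin n) (c : G.Walk v v), c.IsCycle → ¬(3 ≤ c.length ∧ c.length ≤ s)) :
    ∃ w, IsF n s (s.choose 2 + s - 1) w ∧ edgeProd n w univ = 2 ^ G.edgeSet.ncard := by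
  classical
  let x : Finset (Fin n) → ℕ := fun p ↦ if ∃ e ∈ G.edgeSet, e.toFinset = p then 1 else 0
  have hx : ∀ X, edgeSum n x X = (edgePairs G X).card := fun X ↦ by
    simp only [edgeSum, x, edgePairs, card_filter]
  refine ⟨fun p ↦ 2 ^ x p, fun X hX ↦ ?_, ?_⟩
  · have hlt := card_edgePairs_lt (G := G) (X := X) (card_pos.1 (by omega)) (by rwa [hX])
    have : edgeSum n (fun p ↦ 2 ^ x p) X = edgeSum n x X + s.choose 2 := by
      rw [← hX, ← card_powersetCard, card_eq_sum_ones, edgeSum, edgeSum, ← sum_add_distrib]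
      refine sum_congr rfl fun p _ ↦ ?_
      simp only [x]
      split_ifs <;> rfl
    rw [this, hx]
    omega
  · rw [← card_edgePairs_univ, ← hx]
    exact prod_pow_eq_pow_sum _ _ _

end Girth

/-- Sparse case at `q = C(s,2) + s - 1`: for every `s ≥ 2` and `n ≥ s`,
`ex_Π(n, s, C(s,2)+s-1) = 2^{ex(n, {C₃, …, C_s})}`. -/
theorem sparse_case_girth (s n : ℕ) (hs : 2 ≤ s) (hn : s ≤ n) :
    exPi n s (Nat.choose s 2 + s - 1) = 2 ^ exCycles n s := by
  have hub : ∀ P ∈ {P | ∃ w : Finset (Fin n) → ℕ, IsF n s (s.choose 2 + s - 1) w ∧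
      P = edgeProd n w univ}, P ≤ 2 ^ exCycles n s := by
    rintro P ⟨w, hw, rfl⟩
    exact edgeProd_le_two_pow_exCycles hs hn hw
  have hne : {m | ∃ G : SimpleGraph (Fin n),
      (∀ (v : Fin n) (c : G.Walk v v), c.IsCycle → ¬(3 ≤ c.length ∧ c.length ≤ s)) ∧
      m = G.edgeSet.ncard}.Nonempty :=
    ⟨_, ⊥, fun v c hc ↦ absurd hc (SimpleGraph.isAcyclic_bot c), rfl⟩
  obtain ⟨G, hG, hGe⟩ := Nat.sSup_mem hne (bddAbove_edgeSet_ncard _)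
  obtain ⟨w, hw, hP⟩ := exists_isF_edgeProd_eq_two_pow hs hG
  refine le_antisymm (csSup_le ⟨_, w, hw, rfl⟩ hub) ?_
  refine le_csSup ⟨_, hub⟩ ⟨w, hw, ?_⟩
  rw [hP, exCycles, hGe]
end

section
/- Sparse case, linear range: let s ≥ 2 be an integer and let q be an integer with C(s,2) + ⌊s/2⌋ ≤ q < C(s,2) + s − 2. Then for every integer n ≥ s, 2^{⌊n/2⌋} ≤ ex_Π(n, s, q) ≤ 2^{(s−3)n/2}. -/
open Finset

/-- In a multigraph whose pairs all have positive multiplicity, `edgeSum` splits into the number of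
pairs and the total excess over multiplicity one. -/
lemma edgeSum_eq_choose_add_excess {n : ℕ} {w : Finset (Fin n) → ℕ}
    (hw : ∀ p : Finset (Fin n), p.card = 2 → w p ≠ 0) (X : Finset (Fin n)) :
    edgeSum n w X = X.card.choose 2 + ∑ p ∈ X.powersetCard 2, (w p - 1) := by
  rw [edgeSum, ← card_powersetCard, card_eq_sum_ones, ← sum_add_distrib]
  refine sum_congr rfl fun p hp ↦ ?_
  have := hw p (mem_powersetCard.1 hp).2
  omega

/-- A family of natural numbers with sum at least `k` has a subfamily of size at most `k` whose sum
is already at least `k`. -/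
lemma exists_subset_card_le_le_sum {α : Type*} {E : Finset α} {x : α → ℕ} {k : ℕ}
    (h : k ≤ ∑ e ∈ E, x e) : ∃ F ⊆ E, F.card ≤ k ∧ k ≤ ∑ e ∈ F, x e := by
  classical
  rcases le_total k (E.filter (x · ≠ 0)).card with hk | hk
  · obtain ⟨F, hF, rfl⟩ := exists_subset_card_eq hk
    refine ⟨F, hF.trans (filter_subset _ _), le_rfl, ?_⟩
    rw [card_eq_sum_ones]
    exact sum_le_sum fun e he ↦ Nat.one_le_iff_ne_zero.2 (mem_filter.1 (hF he)).2
  · exact ⟨_, filter_subset _ _, hk, by rwa [sum_filter_ne_zero]⟩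

/-- The excess degree of a vertex is less than `k` as soon as every `s`-set, with `k < s`, spans
less than `k` excess. -/
lemma excess_degree_lt {n s k : ℕ} (hks : k < s) (hsn : s ≤ n) {x : Finset (Fin n) → ℕ}
    (h : ∀ X : Finset (Fin n), X.card = s → ∑ p ∈ X.powersetCard 2, x p < k) (v : Fin n) :
    ∑ p ∈ (univ.powersetCard 2).filter (v ∈ ·), x p < k := by
  by_contra! hk
  obtain ⟨F, hF, hFk, hkF⟩ := exists_subset_card_le_le_sum hk
  have hF' : ∀ p ∈ F, p.card = 2 ∧ v ∈ p := fun p hp ↦ by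
    simpa [mem_powersetCard] using hF hp
  set Y := insert v (F.biUnion (·.erase v))
  have hY : Y.card ≤ s := by
    have h₁ : (F.biUnion (·.erase v)).card ≤ F.card * 1 :=
      card_biUnion_le_card_mul _ _ _ fun p hp ↦ by
        rw [card_erase_of_mem (hF' p hp).2, (hF' p hp).1]
    have h₂ : Y.card ≤ _ := card_insert_le v _
    omega
  obtain ⟨X, hYX, hX⟩ := exists_superset_card_eq hY (by simpa using hsn)
  refine (h X hX).not_ge (hkF.trans (sum_le_sum_of_subset fun p hp ↦ ?_))
  refine mem_powersetCard.2 ⟨fun u hu ↦ hYX ?_, (hF' p hp).1⟩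
  by_cases huv : u = v
  · exact huv ▸ mem_insert_self _ _
  · exact mem_insert_of_mem (mem_biUnion.2 ⟨p, hp, mem_erase.2 ⟨huv, hu⟩⟩)

/-- Handshake lemma for weighted pairs. -/
lemma sum_degree_eq_two_mul {n : ℕ} (x : Finset (Fin n) → ℕ) :
    ∑ v, ∑ p ∈ (univ.powersetCard 2).filter (v ∈ ·), x p
      = 2 * ∑ p ∈ (univ : Finset (Fin n)).powersetCard 2, x p := by
  simp_rw [sum_filter]
  rw [sum_comm, mul_sum]
  refine sum_congr rfl fun p hp ↦ ?_
  rw [← sum_filter, sum_const, filter_mem_eq_inter, univ_inter, (mem_powersetCard.1 hp).2,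
    smul_eq_mul]

/-- If `q < C(s,2) + k + 1` with `k + 1 < s`, the edge product of an `(n,s,q)`-graph is at most
`2 ^ (k n / 2)`. -/
lemma edgeProd_le_two_rpow {n s q k : ℕ} (hks : k + 1 < s) (hq : q < s.choose 2 + (k + 1))
    (hsn : s ≤ n) {w : Finset (Fin n) → ℕ} (hw : IsF n s q w) :
    (edgeProd n w univ : ℝ) ≤ (2 : ℝ) ^ ((k : ℝ) * n / 2) := by
  by_cases h0 : ∃ p : Finset (Fin n), p.card = 2 ∧ w p = 0
  · obtain ⟨p, hp, hwp⟩ := h0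
    rw [edgeProd, prod_eq_zero (mem_powersetCard.2 ⟨subset_univ p, hp⟩) hwp, Nat.cast_zero]
    positivity
  push Not at h0
  set e := ∑ p ∈ (univ : Finset (Fin n)).powersetCard 2, (w p - 1) with he
  have hdeg := excess_degree_lt (x := fun p ↦ w p - 1) hks hsn fun X hX ↦ by
    have := hw X hX
    rw [edgeSum_eq_choose_add_excess h0, hX] at this
    omega
  have hsum : 2 * e ≤ n * k := by
    rw [he, ← sum_degree_eq_two_mul]
    simpa using sum_le_card_nsmul univ _ k fun v _ ↦ Nat.lt_succ_iff.1 (hdeg v)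
  have hprod : edgeProd n w univ ≤ 2 ^ e := by
    rw [edgeProd, he, ← prod_pow_eq_pow_sum]
    refine prod_le_prod' fun p _ ↦ ?_
    have := Nat.lt_two_pow_self (n := w p - 1)
    omega
  calc (edgeProd n w univ : ℝ) ≤ (2 : ℝ) ^ (e : ℝ) := by
        rw [Real.rpow_natCast]; exact_mod_cast hprod
    _ ≤ _ := Real.rpow_le_rpow_of_exponent_le one_le_two <| by
        have : (2 : ℝ) * e ≤ n * k := by exact_mod_cast hsum
        linarith

/-- A matching of `⌊n/2⌋` pairs on `Fin n`. -/
lemma exists_matching (n : ℕ) : ∃ M : Finset (Finset (Fin n)), M.card = n / 2 ∧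
    M ⊆ univ.powersetCard 2 ∧ (M : Set (Finset (Fin n))).PairwiseDisjoint id := by
  let g : Fin (n / 2) → Finset (Fin n) := fun k ↦
    {⟨2 * k, by omega⟩, ⟨2 * k + 1, by omega⟩}
  have hd : ∀ i j, i ≠ j → Disjoint (g i) (g j) := fun i j hij ↦ by
    simp only [g, disjoint_insert_left, disjoint_singleton_left, mem_insert, mem_singleton,
      Fin.mk.injEq]
    omega
  have hg : Function.Injective g := fun i j hij ↦ by
    by_contra hne
    have := hd i j hne
    rw [hij, disjoint_self_iff_empty] at this
    simp [g] at this
  refine ⟨univ.image g, by simp [card_image_of_injective _ hg], ?_, ?_⟩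
  · intro p hp
    obtain ⟨k, -, rfl⟩ := mem_image.1 hp
    exact mem_powersetCard.2 ⟨subset_univ _, card_pair (by simp)⟩
  · intro p hp r hr hpr
    obtain ⟨i, -, rfl⟩ := mem_image.1 (mem_coe.1 hp)
    obtain ⟨j, -, rfl⟩ := mem_image.1 (mem_coe.1 hr)
    exact hd i j fun h ↦ hpr (h ▸ rfl)

/-- Doubling the pairs of a matching of size `⌊n/2⌋` gives an `(n,s,C(s,2)+⌊s/2⌋)`-graph. -/
lemma exists_isF_edgeProd_eq_two_pow_s9 {n s q : ℕ} (hq : s.choose 2 + s / 2 ≤ q) :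
    ∃ w, IsF n s q w ∧ edgeProd n w univ = 2 ^ (n / 2) := by
  obtain ⟨M, hM, hM2, hMd⟩ := exists_matching n
  refine ⟨fun p ↦ if p ∈ M then 2 else 1, fun X hX ↦ ?_, ?_⟩
  · rw [edgeSum_eq_choose_add_excess (fun p _ ↦ by split_ifs <;> simp), hX]
    set N := (X.powersetCard 2).filter (· ∈ M)
    have hsum : ∑ p ∈ X.powersetCard 2, ((if p ∈ M then 2 else 1) - 1) = N.card := by
      rw [card_filter]
      exact sum_congr rfl fun p _ ↦ by split_ifs <;> rfl
    have hN : N.card * 2 ≤ s := by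
      rw [← hX, ← sum_const_nat (s := N) (f := card)
        fun p hp ↦ (mem_powersetCard.1 (mem_filter.1 hp).1).2]
      have hNd : (N : Set (Finset (Fin n))).PairwiseDisjoint id :=
        hMd.subset fun p hp ↦ (mem_filter.1 (mem_coe.1 hp)).2
      refine (card_biUnion hNd).symm.trans_le (card_le_card (biUnion_subset.2 fun p hp ↦ ?_))
      exact (mem_powersetCard.1 (mem_filter.1 hp).1).1
    omega
  · rw [edgeProd, prod_ite, prod_const, prod_const_one, mul_one, filter_mem_eq_inter,
      inter_eq_right.2 hM2, hM]

/-- Sparse case, linear range: for `s ≥ 2` and `C(s,2) + ⌊s/2⌋ ≤ q < C(s,2) + s - 2`,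
for every `n ≥ s` one has `2^{⌊n/2⌋} ≤ ex_Π(n,s,q) ≤ 2^{(s-3)n/2}`. -/
theorem sparse_linear_range (s q : ℕ) (hs : 2 ≤ s)
    (hq1 : Nat.choose s 2 + s / 2 ≤ q) (hq2 : q < Nat.choose s 2 + s - 2) :
    ∀ n : ℕ, s ≤ n →
      2 ^ (n / 2) ≤ exPi n s q ∧
      (exPi n s q : ℝ) ≤ (2 : ℝ) ^ (((s : ℝ) - 3) * (n : ℝ) / 2) := by
  intro n hn
  have hle : ∀ P ∈ {P | ∃ w : Finset (Fin n) → ℕ, IsF n s q w ∧ P = edgeProd n w univ},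
      (P : ℝ) ≤ (2 : ℝ) ^ (((s : ℝ) - 3) * (n : ℝ) / 2) := by
    rintro _ ⟨w, hw, rfl⟩
    have h := edgeProd_le_two_rpow (k := s - 3) (by omega) (by omega) hn hw
    rwa [Nat.cast_sub (by omega), Nat.cast_ofNat] at h
  have hbdd : BddAbove {P | ∃ w : Finset (Fin n) → ℕ, IsF n s q w ∧ P = edgeProd n w univ} :=
    ⟨_, fun P hP ↦ Nat.le_floor (hle P hP)⟩
  obtain ⟨w, hw, hP⟩ := exists_isF_edgeProd_eq_two_pow_s9 (n := n) hq1
  exact ⟨le_csSup hbdd ⟨w, hw, hP.symm⟩, hle _ (Nat.sSup_mem ⟨_, w, hw, hP.symm⟩ hbdd)⟩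
end
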